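/- Let T > 0, M ≥ 1, and let a = (a^1,…,a^M) : ℝ^M → ℝ^M be bounded by M_0 and Lipschitz with constant M_1. Suppose u_1, u_2 ∈ [W^{1,∞}([0,T) × ℝ)]^M both satisfy, for each i = 1,…,M, ∂_t u^i + a^i(u) ∂_x u^i = 0 almost everywhere on (0,T) × ℝ, and u_1(0,·) = u_2(0,·). Then u_1 = u_2 almost everywhere on (0,T) × ℝ. -/

import Mathlib

open MeasureTheory Real Set NNReal

/-- Almost every translate of a line transversal to the second axis meets a conull set of the plane
in a conull set of parameters. -/
lemma ae_ae_affine_line {P : ℝ × ℝ → Prop} (hP : ∀ᵐ p, P p) (x c t : ℝ) :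
    ∀ᵐ y : ℝ, ∀ᵐ s : ℝ, P (s, x + c * (s - t) + y) := by
  have hsk : MeasurePreserving (fun p : ℝ × ℝ => (p.1, x + c * (p.1 - t) + p.2))
      ((volume : Measure ℝ).prod volume) ((volume : Measure ℝ).prod volume) :=
    (MeasurePreserving.id volume).skew_product (g := fun s y => x + c * (s - t) + y)
      (by fun_prop) (ae_of_all _ fun s => map_add_left_eq_self volume (x + c * (s - t)))
  have hmp := hsk.comp Measure.measurePreserving_swap
  exact Measure.ae_ae_of_ae_prod (hmp.quasiMeasurePreserving.ae hP)

/-- The mean value inequality for Lipschitz functions whose derivative is bounded almost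
everywhere. -/
lemma LipschitzOnWith.abs_sub_le_of_ae_hasDerivAt {f : ℝ → ℝ} {K : ℝ≥0} {a b D : ℝ} (hab : a ≤ b)
    (hf : LipschitzOnWith K f (Set.Icc a b))
    (hD : ∀ᵐ s : ℝ, s ∈ Set.Ioo a b → ∃ d, HasDerivAt f d s ∧ |d| ≤ D) :
    |f b - f a| ≤ D * (b - a) := by
  rw [← Set.uIcc_of_le hab] at hf
  rw [← hf.absolutelyContinuousOnInterval.integral_deriv_eq_sub, ← Real.norm_eq_abs,
    ← abs_of_nonneg (sub_nonneg.2 hab)]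
  refine intervalIntegral.norm_integral_le_of_norm_le_const_ae ?_
  have hb : ∀ᵐ s : ℝ, s ≠ b := by simp [ae_iff]
  filter_upwards [hD, hb] with s hs hsb hmem
  rw [Set.uIoc_of_le hab] at hmem
  obtain ⟨d, hd, hdD⟩ := hs ⟨hmem.1, lt_of_le_of_ne hmem.2 hsb⟩
  rwa [hd.deriv]

/-- The chain rule along a graph, in terms of partial derivatives. -/
lemma DifferentiableAt.hasDerivAt_along_graph {f : ℝ × ℝ → ℝ} {γ : ℝ → ℝ} {s c ft fx : ℝ}
    (hf : DifferentiableAt ℝ f (s, γ s)) (hγ : HasDerivAt γ c s)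
    (ht : HasDerivAt (fun r => f (r, γ s)) ft s) (hx : HasDerivAt (fun y => f (s, y)) fx (γ s)) :
    HasDerivAt (fun r => f (r, γ r)) (ft + c * fx) s := by
  have hF := hf.hasFDerivAt
  have h1 : HasDerivAt (fun r => f (r, γ s)) (fderiv ℝ f (s, γ s) (1, 0)) s :=
    hF.comp_hasDerivAt (f := fun r : ℝ => (r, γ s)) s
      ((hasDerivAt_id s).prodMk (hasDerivAt_const s (γ s)))
  have h2 : HasDerivAt (fun y => f (s, y)) (fderiv ℝ f (s, γ s) (0, 1)) (γ s) :=
    hF.comp_hasDerivAt (f := fun y : ℝ => (s, y)) (γ s)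
      ((hasDerivAt_const (γ s) s).prodMk (hasDerivAt_id (γ s)))
  have h3 : HasDerivAt (fun r => f (r, γ r)) (fderiv ℝ f (s, γ s) (1, c)) s :=
    hF.comp_hasDerivAt (f := fun r : ℝ => (r, γ r)) s ((hasDerivAt_id s).prodMk hγ)
  rw [ht.unique h1, hx.unique h2]
  convert h3 using 1
  have : ((1 : ℝ), c) = (1, 0) + c • (0, 1) := by simp
  rw [this, map_add, map_smul, smul_eq_mul]

/-- A function on `[0,T) × ℝ` that is Lipschitz with constant `L` and solves the diagonal system
`∂_t u^i + a^i(u) ∂_x u^i = 0` almost everywhere. -/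
structure IsLipschitzSolution {M : ℕ} (T : ℝ) (a : (Fin M → ℝ) → Fin M → ℝ) (L : ℝ≥0)
    (u : ℝ → ℝ → Fin M → ℝ) : Prop where
  lipschitz : LipschitzOnWith L (fun p : ℝ × ℝ => u p.1 p.2)
    (Set.Ico 0 T ×ˢ (Set.univ : Set ℝ))
  ae_eq : ∀ i : Fin M, ∀ᵐ p : ℝ × ℝ, p.1 ∈ Set.Ioo 0 T →
    ∃ ut ux : ℝ, HasDerivAt (fun s => u s p.2 i) ut p.1 ∧
      HasDerivAt (fun y => u p.1 y i) ux p.2 ∧ ut + a (u p.1 p.2) i * ux = 0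

namespace IsLipschitzSolution

variable {M : ℕ} {T : ℝ} {a : (Fin M → ℝ) → Fin M → ℝ} {L : ℝ≥0} {u v : ℝ → ℝ → Fin M → ℝ}

lemma lipschitz_apply (hu : IsLipschitzSolution T a L u) (i : Fin M) :
    LipschitzOnWith L (fun p : ℝ × ℝ => u p.1 p.2 i) (Set.Ico 0 T ×ˢ (Set.univ : Set ℝ)) := by
  rw [← one_mul L]
  exact (LipschitzWith.eval i).comp_lipschitzOnWith hu.lipschitz

protected lemma norm_sub_le (hu : IsLipschitzSolution T a L u) {s t : ℝ} (hs : s ∈ Set.Ico 0 T)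
    (ht : t ∈ Set.Ico 0 T) (x y : ℝ) :
    ‖u s x - u t y‖ ≤ L * max |s - t| |x - y| := by
  simpa [dist_eq_norm, Prod.norm_def] using
    hu.lipschitz.dist_le_mul (s, x) ⟨hs, trivial⟩ (t, y) ⟨ht, trivial⟩

/-- At almost every point, the derivative of a solution along any graph is the spatial derivative
times the difference between the slope of the graph and the characteristic speed. -/
lemma ae_hasDerivAt_along_graph (hu : IsLipschitzSolution T a L u) (i : Fin M) :
    ∀ᵐ p : ℝ × ℝ, p.1 ∈ Set.Ioo 0 T → ∃ ux : ℝ, |ux| ≤ L ∧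
      ∀ (γ : ℝ → ℝ) (c : ℝ), γ p.1 = p.2 → HasDerivAt γ c p.1 →
        HasDerivAt (fun r => u r (γ r) i) ((c - a (u p.1 p.2) i) * ux) p.1 := by
  have hR := ((hu.lipschitz_apply i).mono (Set.prod_mono Set.Ioo_subset_Ico_self
    subset_rfl)).ae_differentiableWithinAt_of_mem (μ := volume)
  filter_upwards [hR, hu.ae_eq i] with ⟨s, z⟩ hd he hs
  obtain ⟨ut, ux, hut, hux, heq⟩ := he hs
  have hdiff := (hd ⟨hs, trivial⟩).differentiableAt
    ((isOpen_Ioo.prod isOpen_univ).mem_nhds ⟨hs, trivial⟩)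
  refine ⟨ux, ?_, fun γ c hγ hγ' => ?_⟩
  · have hl : LipschitzWith L (fun y => u s y i) := by
      refine LipschitzWith.of_dist_le_mul fun y y' => ?_
      simpa [Prod.dist_eq] using (hu.lipschitz_apply i).dist_le_mul (s, y)
        ⟨Set.Ioo_subset_Ico_self hs, trivial⟩ (s, y') ⟨Set.Ioo_subset_Ico_self hs, trivial⟩
    simpa using hux.hasFDerivAt.le_of_lipschitz hl
  · change γ s = z at hγ
    subst hγ
    convert hdiff.hasDerivAt_along_graph hγ' hut hux using 1
    linear_combination -heq

/-- One time step of the stability estimate: moving along straight lines whose slope is a frozen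
characteristic speed costs an error of second order. -/
lemma abs_sub_le_step {M0 : ℝ} {M1 : ℝ≥0} (haB : ∀ v i, |a v i| ≤ M0) (haLip : LipschitzWith M1 a)
    (hu : IsLipschitzSolution T a L u) (hv : IsLipschitzSolution T a L v) {t h δ : ℝ}
    (ht : 0 ≤ t) (h0 : 0 < h) (h1 : h ≤ 1) (hT : t + h < T)
    (hδ : ∀ x i, |u t x i - v t x i| ≤ δ) (x : ℝ) (i : Fin M) :
    |u (t + h) x i - v (t + h) x i| ≤
      (1 + M1 * L * h) * δ + (2 * L + 2 * M1 * L ^ 2 * (M0 + 2)) * h ^ 2 := by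
  have hM0 : 0 ≤ M0 := (abs_nonneg _).trans (haB 0 i)
  have hδ0 : 0 ≤ δ := (abs_nonneg _).trans (hδ 0 i)
  have hL : (0 : ℝ) ≤ L := L.2
  have hM1 : (0 : ℝ) ≤ M1 := M1.2
  have hIco : ∀ s ∈ Set.Icc t (t + h), s ∈ Set.Ico 0 T := fun s hs =>
    ⟨ht.trans hs.1, hs.2.trans_lt hT⟩
  set c := a (u t x) i with hc
  have hcM : |c| ≤ M0 := haB _ _
  have hline := ae_ae_affine_line ((hu.ae_hasDerivAt_along_graph i).and
    (hv.ae_hasDerivAt_along_graph i)) x c (t + h)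
  have hfreq : ∃ᵐ y : ℝ, y ∈ Set.Ioo 0 (h ^ 2) := by
    rw [frequently_ae_mem_iff]
    simp [h0.ne']
  obtain ⟨y, ⟨hy0, hyh⟩, hy⟩ := (hfreq.and_eventually hline).exists
  set γ : ℝ → ℝ := fun s => x + c * (s - (t + h)) + y with hγ
  have hγd : ∀ s, HasDerivAt γ c s := fun s => by
    have := ((((hasDerivAt_id s).sub_const (t + h)).const_mul c).const_add x).add_const y
    rwa [mul_one] at this
  have hγl : LipschitzWith ‖c‖₊ γ := LipschitzWith.of_dist_le_mul fun r s => by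
    simp [hγ, Real.dist_eq, ← mul_sub, abs_mul]
  have hgraph : ∀ w : ℝ → ℝ → Fin M → ℝ, IsLipschitzSolution T a L w →
      LipschitzOnWith (L * max 1 ‖c‖₊) (fun s => w s (γ s) i) (Set.Icc t (t + h)) := fun w hw =>
    (hw.lipschitz_apply i).comp (LipschitzWith.id.prodMk hγl).lipschitzOnWith
      fun s hs => ⟨hIco s hs, trivial⟩
  have hγx : ∀ s ∈ Set.Icc t (t + h), |γ s - x| ≤ (M0 + 1) * h := fun s hs => by
    have h2 : |c * (s - (t + h))| ≤ M0 * h := by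
      rw [abs_mul]
      have : |s - (t + h)| ≤ h := abs_le.2 ⟨by linarith [hs.1], by linarith [hs.2]⟩
      gcongr
    rw [abs_le] at h2 ⊢
    constructor <;> simp only [hγ] <;> nlinarith [h2.1, h2.2]
  have hδn : ∀ z, ‖u t z - v t z‖ ≤ δ := fun z =>
    (pi_norm_le_iff_of_nonneg hδ0).2 fun j => by simpa using hδ z j
  have hcoeff : ∀ p q : Fin M → ℝ, |a p i - a q i| ≤ M1 * ‖p - q‖ := fun p q => by
    simpa [dist_eq_norm] using (norm_le_pi_norm (a p - a q) i).trans
      (by simpa [dist_eq_norm] using haLip.dist_le_mul p q)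
  have hmain : |(u (t + h) (γ (t + h)) i - v (t + h) (γ (t + h)) i) -
      (u t (γ t) i - v t (γ t) i)| ≤
      (M1 * L * δ + 2 * M1 * L ^ 2 * (M0 + 2) * h) * (t + h - t) := by
    refine LipschitzOnWith.abs_sub_le_of_ae_hasDerivAt
      (f := fun s => u s (γ s) i - v s (γ s) i) (by linarith)
      ((hgraph u hu).sub (hgraph v hv)) ?_
    filter_upwards [hy] with s hs hst
    have hs' := Set.Ioo_subset_Icc_self hst
    have hsT : s ∈ Set.Ioo 0 T := ⟨ht.trans_lt hst.1, hst.2.trans hT⟩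
    have htT := hIco t ⟨le_rfl, by linarith⟩
    have hst' : |s - t| ≤ h := abs_le.2 ⟨by linarith [hst.1], by linarith [hst.2]⟩
    obtain ⟨ux, hux, hu'⟩ := hs.1 hsT
    obtain ⟨vx, hvx, hv'⟩ := hs.2 hsT
    refine ⟨_, (hu' γ c rfl (hγd s)).sub (hv' γ c rfl (hγd s)), ?_⟩
    change |(c - a (u s (γ s)) i) * ux - (c - a (v s (γ s)) i) * vx| ≤ _
    have e1 : |c - a (u s (γ s)) i| ≤ M1 * (L * ((M0 + 1) * h)) := by
      rw [abs_sub_comm]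
      refine (hcoeff _ _).trans ?_
      have : max |s - t| |γ s - x| ≤ (M0 + 1) * h := max_le (by nlinarith) (hγx s hs')
      gcongr
      exact (hu.norm_sub_le (hIco s hs') htT _ _).trans (by gcongr)
    have e2 : |a (v s (γ s)) i - a (u s (γ s)) i| ≤ M1 * (2 * L * h + δ) := by
      rw [abs_sub_comm]
      refine (hcoeff _ _).trans ?_
      gcongr
      have n1 := hu.norm_sub_le (hIco s hs') htT (γ s) (γ s)
      have n2 := hv.norm_sub_le (hIco s hs') htT (γ s) (γ s)
      simp only [sub_self, abs_zero, abs_nonneg, sup_of_le_left] at n1 n2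
      have n3 : (L : ℝ) * |s - t| ≤ L * h := by gcongr
      calc ‖u s (γ s) - v s (γ s)‖
          = ‖(u s (γ s) - u t (γ s)) + (u t (γ s) - v t (γ s)) - (v s (γ s) - v t (γ s))‖ := by
            congr 1; abel
        _ ≤ ‖u s (γ s) - u t (γ s)‖ + ‖u t (γ s) - v t (γ s)‖ + ‖v s (γ s) - v t (γ s)‖ :=
            (norm_sub_le _ _).trans (by gcongr; exact norm_add_le _ _)
        _ ≤ _ := by linarith [hδn (γ s)]
    have e3 : |ux - vx| ≤ 2 * L := (abs_sub _ _).trans (by linarith)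
    calc |(c - a (u s (γ s)) i) * ux - (c - a (v s (γ s)) i) * vx|
        = |(c - a (u s (γ s)) i) * (ux - vx) + (a (v s (γ s)) i - a (u s (γ s)) i) * vx| := by
          congr 1; ring
      _ ≤ |c - a (u s (γ s)) i| * |ux - vx| + |a (v s (γ s)) i - a (u s (γ s)) i| * |vx| := by
          rw [← abs_mul, ← abs_mul]
          exact abs_add_le _ _
      _ ≤ M1 * (L * ((M0 + 1) * h)) * (2 * L) + M1 * (2 * L * h + δ) * L := by gcongr
      _ = _ := by ring
  have hend : t + h ∈ Set.Ico 0 T := hIco _ ⟨by linarith, le_rfl⟩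
  have hγe : γ (t + h) = x + y := by simp [hγ]
  have hshift : ∀ w : ℝ → ℝ → Fin M → ℝ, IsLipschitzSolution T a L w →
      |w (t + h) (x + y) i - w (t + h) x i| ≤ L * h ^ 2 := fun w hw => by
    have n1 := (norm_le_pi_norm (w (t + h) (x + y) - w (t + h) x) i).trans
      (hw.norm_sub_le hend hend (x + y) x)
    simp only [Pi.sub_apply, Real.norm_eq_abs, sub_self, abs_zero, add_sub_cancel_left,
      abs_of_pos hy0, max_eq_right hy0.le] at n1
    exact n1.trans (by gcongr)
  have f1 := abs_le.1 (hshift u hu)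
  have f2 := abs_le.1 (hshift v hv)
  have f3 := abs_le.1 (hδ (γ t) i)
  rw [hγe] at hmain
  have f4 := abs_le.1 hmain
  rw [abs_le]
  constructor <;> linarith [f1.1, f1.2, f2.1, f2.2, f3.1, f3.2, f4.1, f4.2]

/-- Two Lipschitz solutions with the same initial data coincide. -/
theorem eq_of_initial_eq {M0 : ℝ} {M1 : ℝ≥0} (haB : ∀ v i, |a v i| ≤ M0)
    (haLip : LipschitzWith M1 a) (hu : IsLipschitzSolution T a L u)
    (hv : IsLipschitzSolution T a L v) (hinit : ∀ x, u 0 x = v 0 x) {t : ℝ}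
    (ht : t ∈ Set.Ioo 0 T) (x : ℝ) : u t x = v t x := by
  ext i
  have hM0 : 0 ≤ M0 := (abs_nonneg _).trans (haB 0 i)
  have hL : (0 : ℝ) ≤ L := L.2
  have hM1 : (0 : ℝ) ≤ M1 := M1.2
  obtain ⟨ht0, htT⟩ := ht
  set A : ℝ := M1 * L with hA
  have hA0 : 0 ≤ A := by positivity
  set C : ℝ := 2 * L + 2 * M1 * L ^ 2 * (M0 + 2) with hC
  have hC0 : 0 ≤ C := by positivity
  have hsteps : ∀ h : ℝ, 0 < h → h ≤ 1 → ∀ k : ℕ, k * h < T → ∀ x i,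
      |u (k * h) x i - v (k * h) x i| ≤ k * (C * h ^ 2) * Real.exp (A * (k * h)) := by
    intro h h0 h1 k
    induction k with
    | zero => intro _ x i; simp [hinit]
    | succ k ih =>
      intro hk x i
      have hkh : ((k + 1 : ℕ) : ℝ) * h = k * h + h := by push_cast; ring
      rw [hkh] at hk ⊢
      refine (abs_sub_le_step haB haLip hu hv (by positivity) h0 h1 hk
        (ih (by linarith)) x i).trans ?_
      have hexp : 1 + A * h ≤ Real.exp (A * h) := by
        linarith [Real.add_one_le_exp (A * h)]
      have hone : 1 ≤ Real.exp (A * (k * h + h)) := Real.one_le_exp (by positivity)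
      calc (1 + A * h) * (k * (C * h ^ 2) * Real.exp (A * (k * h))) + C * h ^ 2
          ≤ Real.exp (A * h) * (k * (C * h ^ 2) * Real.exp (A * (k * h))) +
            C * h ^ 2 * Real.exp (A * (k * h + h)) := by
              exact add_le_add (by gcongr) (le_mul_of_one_le_right (by positivity) hone)
        _ = _ := by rw [mul_add A, Real.exp_add]; push_cast; ring
  have hlim : Filter.Tendsto (fun n : ℕ => C * t ^ 2 * Real.exp (A * t) / (n : ℝ))
      Filter.atTop (nhds 0) := tendsto_const_div_atTop_nhds_zero_nat _
  have hle : |u t x i - v t x i| ≤ 0 := by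
    refine ge_of_tendsto hlim ?_
    filter_upwards [Filter.eventually_ge_atTop (max 1 ⌈t⌉₊)] with n hn
    have hn0 : (0 : ℝ) < n := by exact_mod_cast (le_max_left _ _).trans hn
    have hnt : t ≤ n := (Nat.le_ceil t).trans (by exact_mod_cast (le_max_right _ _).trans hn)
    have hmul : (n : ℝ) * (t / n) = t := by field_simp
    have := hsteps (t / n) (by positivity) ((div_le_one hn0).2 hnt) n (by rwa [hmul]) x i
    rw [hmul] at this
    refine this.trans_eq ?_
    field_simp
  exact sub_eq_zero.1 (abs_nonpos_iff.1 hle)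

end IsLipschitzSolution

/-- Uniqueness of `W^{1,∞}` solutions of the diagonal system
`∂_t u^i + a^i(u) ∂_x u^i = 0` with bounded Lipschitz coefficients `a`: two bounded Lipschitz
solutions on `[0,T) × ℝ` satisfying the equations at almost every point, with the same initial
data, coincide almost everywhere on `(0,T) × ℝ`. -/
theorem uniqueness_W1inf_solutions (T : ℝ) (hT : 0 < T) (M : ℕ) (hM : 1 ≤ M)
    (a : (Fin M → ℝ) → Fin M → ℝ) (M0 : ℝ) (M1 : ℝ≥0)
    (haB : ∀ v i, |a v i| ≤ M0) (haLip : LipschitzWith M1 a)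
    (u1 u2 : ℝ → ℝ → Fin M → ℝ)
    (h1lip : ∃ L : ℝ≥0, LipschitzOnWith L (fun p : ℝ × ℝ => u1 p.1 p.2)
      (Set.Ico 0 T ×ˢ (Set.univ : Set ℝ)))
    (h1bd : ∃ B : ℝ, ∀ t ∈ Set.Ico 0 T, ∀ x : ℝ, ∀ i, |u1 t x i| ≤ B)
    (h2lip : ∃ L : ℝ≥0, LipschitzOnWith L (fun p : ℝ × ℝ => u2 p.1 p.2)
      (Set.Ico 0 T ×ˢ (Set.univ : Set ℝ)))
    (h2bd : ∃ B : ℝ, ∀ t ∈ Set.Ico 0 T, ∀ x : ℝ, ∀ i, |u2 t x i| ≤ B)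
    (h1eq : ∀ i : Fin M, ∀ᵐ p : ℝ × ℝ, p.1 ∈ Set.Ioo 0 T →
      ∃ ut ux : ℝ, HasDerivAt (fun s => u1 s p.2 i) ut p.1 ∧
        HasDerivAt (fun y => u1 p.1 y i) ux p.2 ∧
        ut + a (u1 p.1 p.2) i * ux = 0)
    (h2eq : ∀ i : Fin M, ∀ᵐ p : ℝ × ℝ, p.1 ∈ Set.Ioo 0 T →
      ∃ ut ux : ℝ, HasDerivAt (fun s => u2 s p.2 i) ut p.1 ∧
        HasDerivAt (fun y => u2 p.1 y i) ux p.2 ∧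
        ut + a (u2 p.1 p.2) i * ux = 0)
    (hinit : ∀ x : ℝ, u1 0 x = u2 0 x) :
    ∀ᵐ p : ℝ × ℝ, p.1 ∈ Set.Ioo 0 T → u1 p.1 p.2 = u2 p.1 p.2 := by
  obtain ⟨L1, hL1⟩ := h1lip
  obtain ⟨L2, hL2⟩ := h2lip
  have s1 : IsLipschitzSolution T a (max L1 L2) u1 := ⟨hL1.weaken (le_max_left _ _), h1eq⟩
  have s2 : IsLipschitzSolution T a (max L1 L2) u2 := ⟨hL2.weaken (le_max_right _ _), h2eq⟩
  exact Filter.Eventually.of_forall fun p hp => s1.eq_of_initial_eq haB haLip s2 hinit hp p.2
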